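/- arXiv:2603.23734 — 2 statements merged into one kernel-verified Lean document; each statement's English description precedes it below -/
import Mathlib

section
/- There exists a holomorphic function p* on the open unit disc 𝔻 with Re p*(z) > 0 for all z ∈ 𝔻 such that for every real β < 2, it is NOT the case that I_{p*}(r) = O((1-r)^{-β}) as r → 1⁻; i.e., for every C > 0 and every r₀ ∈ (0,1) there exists r ∈ (r₀,1) with I_{p*}(r) > C (1-r)^{-β}. -/
open Filter Set

/-- The integral mean `I_p(r) = ∫₀^{2π} |z p'(z)/p(z)|² dθ`, `z = r e^{iθ}`. -/
noncomputable def Ip (p : ℂ → ℂ) (r : ℝ) : ℝ :=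
  ∫ θ in (0:ℝ)..(2 * Real.pi),
    ‖(↑r * Complex.exp (↑θ * Complex.I)) * deriv p (↑r * Complex.exp (↑θ * Complex.I)) /
      p (↑r * Complex.exp (↑θ * Complex.I))‖ ^ 2

theorem integral_exp_int_mul_I (m : ℤ) :
    ∫ θ in (0:ℝ)..(2 * Real.pi), Complex.exp ((m * Complex.I) * θ) =
      if m = 0 then 2 * Real.pi else 0 := by
  split_ifs with h
  · simp [h]
  · have hc : (m : ℂ) * Complex.I ≠ 0 := by simp [h]
    rw [integral_exp_mul_complex hc]
    have : Complex.exp (m * Complex.I * ((2 * Real.pi : ℝ) : ℂ)) = 1 := by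
      rw [Complex.exp_eq_one_iff]
      exact ⟨m, by push_cast; ring⟩
    rw [this]
    simp

/-- A one-coefficient form of Bessel's inequality. -/
theorem two_pi_mul_sq_le_integral_norm_sq {G : ℝ → ℂ} (hG : Continuous G) (n : ℕ) (c : ℝ)
    (h : ∫ θ in (0:ℝ)..(2 * Real.pi), Complex.exp (-(n * Complex.I * θ)) * G θ =
      2 * Real.pi * c) :
    2 * Real.pi * c ^ 2 ≤ ∫ θ in (0:ℝ)..(2 * Real.pi), ‖G θ‖ ^ 2 := by
  set H : ℝ → ℂ := fun θ => Complex.exp (-(n * Complex.I * θ)) * G θ with hH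
  have hHc : Continuous H := by fun_prop
  have hnorm (θ : ℝ) : ‖G θ‖ = ‖H θ‖ := by
    have : -(n * Complex.I * θ) = ((-(n * θ) : ℝ) : ℂ) * Complex.I := by push_cast; ring
    rw [hH]
    simp only
    rw [norm_mul, this, Complex.norm_exp_ofReal_mul_I, one_mul]
  have hre : ∫ θ in (0:ℝ)..(2 * Real.pi), (H θ).re = 2 * Real.pi * c := by
    have := Complex.reCLM.intervalIntegral_comp_comm (μ := MeasureTheory.volume)
      (hHc.intervalIntegrable 0 (2 * Real.pi))
    simp only [Complex.reCLM_apply] at this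
    rw [this, h]
    norm_cast
  calc 2 * Real.pi * c ^ 2
      = ∫ θ in (0:ℝ)..(2 * Real.pi), (2 * c * (H θ).re - c ^ 2) := by
        rw [intervalIntegral.integral_sub, intervalIntegral.integral_const_mul, hre]
        · simp only [intervalIntegral.integral_const, smul_eq_mul]; ring
        · exact Continuous.intervalIntegrable (by fun_prop) _ _
        · exact Continuous.intervalIntegrable (by fun_prop) _ _
    _ ≤ _ := by
        refine intervalIntegral.integral_mono_on (by positivity)
          (Continuous.intervalIntegrable (by fun_prop) _ _)
          (Continuous.intervalIntegrable (by fun_prop) _ _) fun θ _ => ?_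
        rw [hnorm, ← Complex.normSq_eq_norm_sq, Complex.normSq_apply]
        nlinarith [sq_nonneg ((H θ).re - c), sq_nonneg (H θ).im]

section GapSeries

variable {a : ℕ → ℝ} {n : ℕ → ℕ}

theorem norm_coeff_mul_pow_le (ha : ∀ k, 0 ≤ a k) (k : ℕ) {z : ℂ}
    (hz : z ∈ Metric.ball (0:ℂ) 1) : ‖(a k : ℂ) * z ^ n k‖ ≤ a k := by
  rw [mem_ball_zero_iff] at hz
  rw [norm_mul, norm_pow, Complex.norm_real, Real.norm_of_nonneg (ha k)]
  exact mul_le_of_le_one_right (ha k) (pow_le_one₀ (norm_nonneg z) hz.le)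

theorem differentiableOn_gapSeries (ha : ∀ k, 0 ≤ a k) (hs : Summable a) :
    DifferentiableOn ℂ (fun z : ℂ => ∑' k, (a k : ℂ) * z ^ n k) (Metric.ball 0 1) :=
  Complex.differentiableOn_tsum_of_summable_norm hs (fun k => by fun_prop) Metric.isOpen_ball
    fun k _ hz => norm_coeff_mul_pow_le ha k hz

theorem hasSum_mul_deriv_gapSeries (ha : ∀ k, 0 ≤ a k) (hs : Summable a) {z : ℂ}
    (hz : z ∈ Metric.ball (0:ℂ) 1) :
    HasSum (fun k => ((n k * a k : ℝ) : ℂ) * z ^ n k)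
      (z * deriv (fun z : ℂ => ∑' k, (a k : ℂ) * z ^ n k) z) := by
  have := (Complex.hasSum_deriv_of_summable_norm (F := fun k (z : ℂ) => (a k : ℂ) * z ^ n k) hs
    (fun k => by fun_prop) Metric.isOpen_ball
    (fun k _ hz => norm_coeff_mul_pow_le ha k hz) hz).mul_left z
  refine this.congr_fun fun k => ?_
  simp only [deriv_const_mul_field', deriv_pow_field]
  rcases Nat.eq_zero_or_pos (n k) with h | h
  · simp [h]
  · obtain ⟨m, hm⟩ := Nat.exists_eq_succ_of_ne_zero h.ne'
    simp only [hm, Nat.succ_eq_add_one, Nat.add_sub_cancel]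
    push_cast
    ring

theorem le_Ip_exp_gapSeries (ha : ∀ k, 0 ≤ a k) (hs : Summable a) (hn : n.Injective) {r : ℝ}
    (hr0 : 0 ≤ r) (hr1 : r < 1) (j : ℕ) :
    2 * Real.pi * (n j * a j * r ^ n j) ^ 2 ≤
      Ip (fun z => Complex.exp (∑' k, (a k : ℂ) * z ^ n k)) r := by
  set f : ℂ → ℂ := fun z => ∑' k, (a k : ℂ) * z ^ n k with hf
  have hfd : DifferentiableOn ℂ f (Metric.ball 0 1) := differentiableOn_gapSeries ha hs
  set w : ℝ → ℂ := fun θ => r * Complex.exp (θ * Complex.I) with hw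
  have hwc : Continuous w := by fun_prop
  have hwmem (θ : ℝ) : w θ ∈ Metric.ball (0:ℂ) 1 := by
    rw [mem_ball_zero_iff, hw]
    simpa [Complex.norm_exp_ofReal_mul_I, abs_of_nonneg hr0] using hr1
  have hG : Continuous fun θ => w θ * deriv f (w θ) :=
    hwc.mul ((hfd.deriv Metric.isOpen_ball).continuousOn.comp_continuous hwc hwmem)
  have hIp : Ip (fun z => Complex.exp (f z)) r =
      ∫ θ in (0:ℝ)..(2 * Real.pi), ‖w θ * deriv f (w θ)‖ ^ 2 := by
    unfold Ip
    refine intervalIntegral.integral_congr fun θ _ => ?_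
    have hd : DifferentiableAt ℂ f (w θ) :=
      hfd.differentiableAt (Metric.isOpen_ball.mem_nhds (hwmem θ))
    change ‖w θ * deriv (fun z => Complex.exp (f z)) (w θ) / Complex.exp (f (w θ))‖ ^ 2 = _
    rw [deriv_cexp hd]
    congr 2
    field_simp [Complex.exp_ne_zero]
  rw [hIp]
  refine two_pi_mul_sq_le_integral_norm_sq hG (n j) _ ?_
  have hsum : Summable fun k => n k * a k * r ^ n k := by
    have h := (hasSum_mul_deriv_gapSeries (n := n) ha hs (z := (r : ℂ))
      (by simpa [abs_of_nonneg hr0] using hr1)).summable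
    rw [← Complex.summable_ofReal]
    simpa using h
  have hterm (k : ℕ) (θ : ℝ) : Complex.exp (-(n j * Complex.I * θ)) *
      (((n k * a k : ℝ) : ℂ) * w θ ^ n k) = ((n k * a k * r ^ n k : ℝ) : ℂ) *
        Complex.exp ((((n k : ℤ) - (n j : ℤ) : ℤ) : ℂ) * Complex.I * θ) := by
    have : (((n k : ℤ) - (n j : ℤ) : ℤ) : ℂ) * Complex.I * θ =
        -(n j * Complex.I * θ) + n k * (θ * Complex.I) := by push_cast; ring
    rw [this, Complex.exp_add, hw, mul_pow, ← Complex.exp_nat_mul]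
    push_cast
    ring
  have key := intervalIntegral.hasSum_integral_of_dominated_convergence
    (μ := MeasureTheory.volume) (a := 0) (b := 2 * Real.pi)
    (F := fun k (θ : ℝ) => Complex.exp (-(n j * Complex.I * θ)) *
      (((n k * a k : ℝ) : ℂ) * w θ ^ n k))
    (f := fun θ => Complex.exp (-(n j * Complex.I * θ)) * (w θ * deriv f (w θ)))
    (fun k _ => n k * a k * r ^ n k)
    (fun k => Continuous.aestronglyMeasurable (by fun_prop))
    (fun k => Eventually.of_forall fun θ _ => by
      have h0 : 0 ≤ n k * a k * r ^ n k :=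
        mul_nonneg (mul_nonneg (Nat.cast_nonneg _) (ha k)) (pow_nonneg hr0 _)
      have : (((n k : ℤ) - (n j : ℤ) : ℤ) : ℂ) * Complex.I * θ =
        ((((n k : ℝ) - n j) * θ : ℝ) : ℂ) * Complex.I := by push_cast; ring
      rw [hterm, norm_mul, this, Complex.norm_exp_ofReal_mul_I, mul_one, Complex.norm_real,
        Real.norm_of_nonneg h0])
    (Eventually.of_forall fun _ _ => hsum)
    intervalIntegrable_const
    (Eventually.of_forall fun θ _ => (hasSum_mul_deriv_gapSeries ha hs (hwmem θ)).mul_left _)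
  simp only [hterm, intervalIntegral.integral_const_mul, integral_exp_int_mul_I, sub_eq_zero,
    Nat.cast_inj, hn.eq_iff] at key
  rw [key.unique (hasSum_single j fun k hk => by simp [hk])]
  simp [mul_comm]

end GapSeries

theorem eventually_const_mul_rpow_lt {β : ℝ} (hβ : β < 2) (C : ℝ) :
    ∀ᶠ k : ℕ in atTop, C * (2 * 2 ^ k ^ 2 : ℝ) ^ β <
      2 * Real.pi * ((2 ^ k ^ 2 : ℝ) * (1 / 2) ^ (k + 1) * (1 / 2)) ^ 2 := by
  have hlin : Tendsto (fun k : ℕ => (k : ℝ) * ((2 - β) * k - 2) - (4 + β)) atTop atTop := by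
    refine tendsto_atTop_add_const_right _ _ ?_
    refine tendsto_natCast_atTop_atTop.atTop_mul_atTop₀ ?_
    exact tendsto_atTop_add_const_right _ _
      (tendsto_natCast_atTop_atTop.const_mul_atTop (by linarith))
  have hexp := (tendsto_rpow_atTop_of_base_gt_one 2 one_lt_two).comp hlin
  filter_upwards [hexp.eventually_gt_atTop C] with k hk
  simp only [Function.comp_apply] at hk
  have e1 : (2 * 2 ^ k ^ 2 : ℝ) ^ β = (2:ℝ) ^ (((k:ℝ) ^ 2 + 1) * β) := by
    rw [Real.rpow_mul zero_le_two, Real.rpow_add_one two_ne_zero, mul_comm]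
    norm_cast
  have e2 : ((2 ^ k ^ 2 : ℝ) * (1 / 2) ^ (k + 1) * (1 / 2)) ^ 2 =
      (2:ℝ) ^ ((k : ℝ) * ((2 - β) * k - 2) - (4 + β)) * (2:ℝ) ^ (((k:ℝ) ^ 2 + 1) * β) := by
    rw [← Real.rpow_add two_pos]
    have : (k : ℝ) * ((2 - β) * k - 2) - (4 + β) + ((k:ℝ) ^ 2 + 1) * β =
        ((k ^ 2 * 2 : ℕ) : ℝ) - ((k * 2 + 4 : ℕ) : ℝ) := by push_cast; ring
    rw [this, Real.rpow_sub two_pos, Real.rpow_natCast, Real.rpow_natCast, pow_mul,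
      pow_add 2 (k * 2) 4, pow_mul 2 k 2]
    simp only [one_div, inv_pow, pow_succ (2:ℝ) k]
    field_simp
  rw [e1, e2, ← mul_assoc]
  refine mul_lt_mul_of_pos_right (hk.trans_le ?_) (by positivity)
  exact le_mul_of_one_le_left (by positivity) (by linarith [Real.pi_gt_three])

/-- Sharpness on the power scale: there is `p* ∈ 𝒫` such that for every `β < 2`,
`I_{p*}(r)` is not `O((1-r)^{-β})` as `r → 1⁻`. -/
theorem stmt2 :
    ∃ p : ℂ → ℂ, DifferentiableOn ℂ p (Metric.ball (0:ℂ) 1) ∧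
      (∀ z ∈ Metric.ball (0:ℂ) 1, 0 < (p z).re) ∧
      ∀ β : ℝ, β < 2 → ∀ C : ℝ, 0 < C → ∀ r₀ ∈ Set.Ioo (0:ℝ) 1,
        ∃ r ∈ Set.Ioo r₀ 1, C * (1 - r) ^ (-β) < Ip p r := by
  set a : ℕ → ℝ := fun k => (1 / 2) ^ (k + 1) with ha_def
  set n : ℕ → ℕ := fun k => 2 ^ k ^ 2 with hn_def
  have ha (k : ℕ) : 0 ≤ a k := by positivity
  have hsum : HasSum a 1 := by
    simpa [ha_def, pow_succ] using hasSum_geometric_two.mul_right (1 / 2 : ℝ)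
  have hn : n.Injective :=
    (Nat.pow_right_injective le_rfl).comp (Nat.pow_left_injective two_ne_zero)
  refine ⟨fun z => Complex.exp (∑' k, (a k : ℂ) * z ^ n k),
    (differentiableOn_gapSeries ha hsum.summable).cexp, fun z hz => ?_, fun β hβ C _ r₀ hr₀ => ?_⟩
  · have hle : ‖∑' k, (a k : ℂ) * z ^ n k‖ ≤ 1 :=
      tsum_of_norm_bounded hsum fun k => norm_coeff_mul_pow_le ha k hz
    have him := abs_le.mp ((Complex.abs_im_le_norm _).trans hle)
    rw [Complex.exp_re]
    exact mul_pos (Real.exp_pos _) (Real.cos_pos_of_mem_Ioo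
      ⟨by linarith [Real.pi_gt_three], by linarith [Real.pi_gt_three]⟩)
  · have hto : Tendsto (fun k : ℕ => (2 * 2 ^ k ^ 2 : ℝ)⁻¹) atTop (nhds 0) :=
      (((tendsto_pow_atTop_atTop_of_one_lt one_lt_two).comp
        (tendsto_pow_atTop two_ne_zero)).const_mul_atTop two_pos).inv_tendsto_atTop
    obtain ⟨k, hk, hkr⟩ := ((eventually_const_mul_rpow_lt hβ C).and
      (hto.eventually_lt_const (sub_pos.mpr hr₀.2))).exists
    set N : ℝ := 2 ^ k ^ 2 with hN
    have hN1 : 1 ≤ N := one_le_pow₀ one_le_two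
    have hpos : 0 < (2 * N)⁻¹ := by positivity
    have hr0 : 0 ≤ 1 - (2 * N)⁻¹ := by linarith [hr₀.1]
    refine ⟨1 - (2 * N)⁻¹, ⟨by linarith, by linarith⟩, ?_⟩
    have hbern : 1 / 2 ≤ (1 - (2 * N)⁻¹) ^ n k := by
      have h := one_add_mul_le_pow (a := -(2 * N)⁻¹) (by linarith) (n k)
      have hc : ((n k : ℕ) : ℝ) = N := by simp [hn_def, hN]
      rw [hc, ← sub_eq_add_neg] at h
      refine le_trans (le_of_eq ?_) h
      field_simp
      norm_num
    calc C * (1 - (1 - (2 * N)⁻¹)) ^ (-β) = C * (2 * N) ^ β := by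
          rw [sub_sub_cancel, Real.inv_rpow (by positivity), Real.rpow_neg (by positivity),
            inv_inv]
      _ < 2 * Real.pi * (N * (1 / 2) ^ (k + 1) * (1 / 2)) ^ 2 := hk
      _ ≤ 2 * Real.pi * (n k * a k * (1 - (2 * N)⁻¹) ^ n k) ^ 2 := by
          have hc : ((n k : ℕ) : ℝ) = N := by simp [hn_def, hN]
          rw [hc]
          gcongr
      _ ≤ _ := le_Ip_exp_gapSeries ha hsum.summable hn hr0 (by linarith) k
end

section
/- Let (n_k)_{k≥1} be any strictly increasing sequence of positive integers and define F(z) = (i/2) ∑_{k=1}^{∞} z^{n_k}/k². Then the series converges absolutely and uniformly on the closed unit disc, |Im F(z)| ≤ π²/12 < π/2 for all |z| ≤ 1, and p(z) = e^{F(z)} is holomorphic on the open unit disc 𝔻 with Re p(z) > 0 for all z ∈ 𝔻. Moreover, for every 0 < r < 1, ∫₀^{2π} |z p'(z)/p(z)|² dθ = (π/2) ∑_{k=1}^{∞} (n_k²/k⁴) r^{2 n_k}, where z = r e^{iθ}. -/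
open Filter Set

theorem integral_exp_natCast_sub_natCast_mul_I (a b : ℕ) :
    ∫ θ in (0:ℝ)..(2 * Real.pi), Complex.exp (((a : ℂ) - b) * Complex.I * θ) =
      ((if a = b then 2 * Real.pi else 0 : ℝ) : ℂ) := by
  split_ifs with h
  · simp [h]
  · have hab : (a : ℂ) - b ≠ 0 := sub_ne_zero.mpr (by exact_mod_cast h)
    rw [integral_exp_mul_complex (mul_ne_zero hab Complex.I_ne_zero)]
    have h2 : Complex.exp (((a : ℂ) - b) * Complex.I * (2 * Real.pi)) = 1 :=
      Complex.exp_eq_one_iff.mpr ⟨(a : ℤ) - b, by push_cast; ring⟩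
    simp [h2]

theorem exp_natCast_sub_natCast_mul_I (a b : ℕ) (θ : ℝ) :
    Complex.exp (((a : ℂ) - b) * Complex.I * θ) =
      Complex.exp (θ * Complex.I) ^ a * (starRingEnd ℂ) (Complex.exp (θ * Complex.I) ^ b) := by
  rw [map_pow, ← Complex.exp_conj, ← Complex.exp_nat_mul, ← Complex.exp_nat_mul,
    ← Complex.exp_add]
  congr 1
  simp only [map_mul, Complex.conj_I, Complex.conj_ofReal]
  ring

theorem hasSum_mul_conj_norm_sq_tsum {ι : Type*} {f : ι → ℂ} (hf : Summable fun k => ‖f k‖) :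
    HasSum (fun x : ι × ι => f x.1 * (starRingEnd ℂ) (f x.2)) ((‖∑' k, f k‖ ^ 2 : ℝ) : ℂ) := by
  have hg : Summable fun k => ‖(starRingEnd ℂ) (f k)‖ := by simpa only [RCLike.norm_conj] using hf
  have h := (summable_mul_of_summable_norm hf hg).hasSum
  rw [← tsum_mul_tsum_of_summable_norm hf hg, ← Complex.conj_tsum, Complex.mul_conj'] at h
  rw [Complex.ofReal_pow]
  exact h

/-- Parseval's identity for an absolutely convergent series of distinct exponentials. -/
theorem integral_norm_sq_tsum_exp {n : ℕ → ℕ} (hn : Function.Injective n) {c : ℕ → ℂ}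
    (hc : Summable fun k => ‖c k‖) :
    ∫ θ in (0:ℝ)..(2 * Real.pi), ‖∑' k, c k * Complex.exp (θ * Complex.I) ^ n k‖ ^ 2 =
      2 * Real.pi * ∑' k, ‖c k‖ ^ 2 := by
  have hnorm : ∀ (θ : ℝ) k, ‖c k * Complex.exp (θ * Complex.I) ^ n k‖ = ‖c k‖ := fun θ k => by
    simp [Complex.norm_exp_ofReal_mul_I]
  have hcc : Summable fun x : ℕ × ℕ => ‖c x.1‖ * ‖c x.2‖ :=
    hc.mul_of_nonneg hc (fun _ => norm_nonneg _) fun _ => norm_nonneg _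
  have hexp : ∀ (θ : ℝ) (x : ℕ × ℕ),
      c x.1 * (starRingEnd ℂ) (c x.2) * Complex.exp (((n x.1 : ℂ) - n x.2) * Complex.I * θ) =
        (c x.1 * Complex.exp (θ * Complex.I) ^ n x.1) *
          (starRingEnd ℂ) (c x.2 * Complex.exp (θ * Complex.I) ^ n x.2) := fun θ x => by
    rw [exp_natCast_sub_natCast_mul_I, map_mul]
    ring
  have hsum : ∀ θ : ℝ, HasSum (fun x : ℕ × ℕ =>
      c x.1 * (starRingEnd ℂ) (c x.2) * Complex.exp (((n x.1 : ℂ) - n x.2) * Complex.I * θ))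
      ((‖∑' k, c k * Complex.exp (θ * Complex.I) ^ n k‖ ^ 2 : ℝ) : ℂ) := fun θ => by
    simp only [hexp]
    exact hasSum_mul_conj_norm_sq_tsum (f := fun k => c k * Complex.exp (θ * Complex.I) ^ n k)
      (by simpa only [hnorm] using hc)
  have hswap := intervalIntegral.hasSum_integral_of_dominated_convergence
    (μ := MeasureTheory.volume) (a := 0) (b := 2 * Real.pi)
    (fun (x : ℕ × ℕ) (_ : ℝ) => ‖c x.1‖ * ‖c x.2‖)
    (fun x => by fun_prop)
    (fun x => Eventually.of_forall fun θ _ => by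
      rw [hexp, norm_mul, RCLike.norm_conj, hnorm, hnorm])
    (Eventually.of_forall fun _ _ => hcc) intervalIntegrable_const
    (Eventually.of_forall fun θ _ => hsum θ)
  simp only [intervalIntegral.integral_const_mul, integral_exp_natCast_sub_natCast_mul_I,
    intervalIntegral.integral_ofReal, hn.eq_iff] at hswap
  have hdiag : Function.Injective fun k : ℕ => (k, k) := fun a b h => (Prod.mk.inj h).1
  apply Complex.ofReal_injective
  rw [← hswap.tsum_eq, ← hdiag.tsum_eq]
  · push_cast
    rw [← tsum_mul_left]
    refine tsum_congr fun k => ?_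
    rw [if_pos rfl, Complex.mul_conj']
    push_cast
    ring
  · rintro ⟨a, b⟩ h
    by_cases hab : a = b
    · exact ⟨a, by rw [hab]⟩
    · simp [hab] at h

theorem hasSum_one_div_add_one_sq :
    HasSum (fun k : ℕ => 1 / ((k : ℝ) + 1) ^ 2) (Real.pi ^ 2 / 6) := by
  have h := (hasSum_nat_add_iff' 1).mpr hasSum_zeta_two
  simpa using h

theorem norm_pow_div_add_one_sq_le (m k : ℕ) {z : ℂ} (hz : ‖z‖ ≤ 1) :
    ‖z ^ m / ((k : ℂ) + 1) ^ 2‖ ≤ 1 / ((k : ℝ) + 1) ^ 2 := by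
  have : ‖(k : ℂ) + 1‖ = (k : ℝ) + 1 := by
    exact_mod_cast Complex.norm_natCast (k + 1)
  rw [norm_div, norm_pow, norm_pow, this]
  gcongr
  exact pow_le_one₀ (norm_nonneg z) hz

/-- General lacunary construction: for any strictly increasing sequence of
positive integers `n_k` (indexed here by `k+1`, `k : ℕ`), the series
`F(z) = (i/2) ∑_{k≥1} z^{n_k}/k²` converges absolutely and uniformly on the
closed disc, `|Im F| ≤ π²/12 < π/2` there, `p = e^F` lies in the Carathéodory
class, and `I_p(r) = (π/2) ∑_{k≥1} (n_k²/k⁴) r^{2 n_k}` for `0 < r < 1`. -/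
theorem stmt14 (n : ℕ → ℕ) (hmono : StrictMono n) (hpos : ∀ k, 0 < n k) :
    (∀ z ∈ Metric.closedBall (0:ℂ) 1,
      Summable (fun k : ℕ => ‖z ^ n k / ((k : ℂ) + 1) ^ 2‖)) ∧
    TendstoUniformlyOn
      (fun N : ℕ => fun z : ℂ => ∑ k ∈ Finset.range N, z ^ n k / ((k : ℂ) + 1) ^ 2)
      (fun z : ℂ => ∑' k : ℕ, z ^ n k / ((k : ℂ) + 1) ^ 2)
      atTop (Metric.closedBall (0:ℂ) 1) ∧
    (∀ z ∈ Metric.closedBall (0:ℂ) 1,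
      |((Complex.I / 2 * ∑' k : ℕ, z ^ n k / ((k : ℂ) + 1) ^ 2)).im| ≤ Real.pi ^ 2 / 12) ∧
    Real.pi ^ 2 / 12 < Real.pi / 2 ∧
    DifferentiableOn ℂ
      (fun z : ℂ => Complex.exp (Complex.I / 2 * ∑' k : ℕ, z ^ n k / ((k : ℂ) + 1) ^ 2))
      (Metric.ball (0:ℂ) 1) ∧
    (∀ z ∈ Metric.ball (0:ℂ) 1,
      0 < (Complex.exp (Complex.I / 2 * ∑' k : ℕ, z ^ n k / ((k : ℂ) + 1) ^ 2)).re) ∧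
    ∀ r ∈ Set.Ioo (0:ℝ) 1,
      Ip (fun z : ℂ => Complex.exp (Complex.I / 2 * ∑' k : ℕ, z ^ n k / ((k : ℂ) + 1) ^ 2)) r
        = Real.pi / 2 * ∑' k : ℕ, ((n k : ℝ) ^ 2 / ((k : ℝ) + 1) ^ 4) * r ^ (2 * n k) := by
  have hle : ∀ k, ∀ z ∈ Metric.closedBall (0:ℂ) 1,
      ‖z ^ n k / ((k : ℂ) + 1) ^ 2‖ ≤ 1 / ((k : ℝ) + 1) ^ 2 := fun k z hz =>
    norm_pow_div_add_one_sq_le _ _ (by simpa using hz)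
  have hu := hasSum_one_div_add_one_sq
  have hsub := Metric.ball_subset_closedBall (x := (0:ℂ)) (ε := 1)
  have him : ∀ z ∈ Metric.closedBall (0:ℂ) 1,
      |((Complex.I / 2 * ∑' k : ℕ, z ^ n k / ((k : ℂ) + 1) ^ 2)).im| ≤ Real.pi ^ 2 / 12 := by
    intro z hz
    refine (Complex.abs_im_le_norm _).trans ?_
    have := tsum_of_norm_bounded hu fun k => hle k z hz
    rw [norm_mul, norm_div, Complex.norm_I, RCLike.norm_ofNat]
    linarith
  have hpi : Real.pi ^ 2 / 12 < Real.pi / 2 := by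
    nlinarith [Real.pi_pos, Real.pi_lt_four]
  have hterm : ∀ k, DifferentiableOn ℂ (fun z : ℂ => z ^ n k / ((k : ℂ) + 1) ^ 2)
      (Metric.ball (0:ℂ) 1) := fun k =>
    ((differentiable_id.pow _).div_const _).differentiableOn
  have hdiff := Complex.differentiableOn_tsum_of_summable_norm hu.summable hterm
    Metric.isOpen_ball fun k z hz => hle k z (hsub hz)
  have hderiv : ∀ z ∈ Metric.ball (0:ℂ) 1,
      HasSum (fun k : ℕ => (n k : ℂ) * z ^ (n k - 1) / ((k : ℂ) + 1) ^ 2)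
        (deriv (fun w : ℂ => ∑' k : ℕ, w ^ n k / ((k : ℂ) + 1) ^ 2) z) := fun z hz => by
    simpa only [deriv_div_const, deriv_pow_field] using
      Complex.hasSum_deriv_of_summable_norm hu.summable hterm Metric.isOpen_ball
        (fun k z hz => hle k z (hsub hz)) hz
  refine ⟨fun z hz => hu.summable.of_nonneg_of_le (fun _ => norm_nonneg _) fun k => hle k z hz,
    tendstoUniformlyOn_tsum_nat hu.summable hle, him, hpi, (hdiff.const_mul _).cexp,
    fun z hz => ?_, ?_⟩
  · rw [Complex.exp_re]
    have := abs_lt.mp ((him z (hsub hz)).trans_lt hpi)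
    exact mul_pos (Real.exp_pos _)
      (Real.cos_pos_of_mem_Ioo ⟨by linarith [this.1], this.2⟩)
  · rintro r ⟨hr0, hr1⟩
    set c : ℕ → ℂ := fun k => Complex.I / 2 * (n k * (r : ℂ) ^ n k / ((k : ℂ) + 1) ^ 2) with hc_def
    have hlog : ∀ z ∈ Metric.ball (0:ℂ) 1,
        HasSum (fun k : ℕ => Complex.I / 2 * (n k * z ^ n k / ((k : ℂ) + 1) ^ 2))
          (z * deriv (fun z : ℂ =>
            Complex.exp (Complex.I / 2 * ∑' k : ℕ, z ^ n k / ((k : ℂ) + 1) ^ 2)) z /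
            Complex.exp (Complex.I / 2 * ∑' k : ℕ, z ^ n k / ((k : ℂ) + 1) ^ 2)) := by
      intro z hz
      have hd := (hdiff.differentiableAt (Metric.isOpen_ball.mem_nhds hz)).hasDerivAt
      rw [(hd.const_mul (Complex.I / 2)).cexp.deriv]
      convert! (hderiv z hz).mul_left (Complex.I / 2 * z) using 1
      · ext k
        rw [← pow_sub_one_mul (hpos k).ne' z]
        ring
      · field_simp
    have hc : Summable fun k => ‖c k‖ :=
      (hlog r (by simpa [abs_of_pos hr0] using hr1)).summable.norm
    have hnorm : ∀ k, ‖c k‖ ^ 2 =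
        1 / 4 * ((n k : ℝ) ^ 2 / ((k : ℝ) + 1) ^ 4 * r ^ (2 * n k)) := fun k => by
      have : ‖(k : ℂ) + 1‖ = (k : ℝ) + 1 := by
        exact_mod_cast Complex.norm_natCast (k + 1)
      simp only [hc_def, norm_mul, norm_div, norm_pow, this, Complex.norm_I, RCLike.norm_ofNat,
        Complex.norm_natCast, Complex.norm_real, Real.norm_of_nonneg hr0.le]
      field_simp
      ring
    have hIp : ∀ θ : ℝ, (r * Complex.exp (θ * Complex.I) : ℂ) ∈ Metric.ball (0:ℂ) 1 := fun θ => by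
      simpa [Complex.norm_exp_ofReal_mul_I, abs_of_pos hr0] using hr1
    have hterms : ∀ (θ : ℝ) (k : ℕ),
        Complex.I / 2 * (n k * (r * Complex.exp (θ * Complex.I)) ^ n k / ((k : ℂ) + 1) ^ 2) =
          c k * Complex.exp (θ * Complex.I) ^ n k := fun θ k => by
      simp only [hc_def, mul_pow]
      ring
    simp only [Ip, ← (hlog _ (hIp _)).tsum_eq, hterms]
    rw [integral_norm_sq_tsum_exp hmono.injective hc]
    simp only [hnorm, tsum_mul_left]
    ring
end
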